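/- Let a ≥ 1 be a natural number with m = a² + 3a + 9 squarefree, let α be a root of f_a = x³ − a·x² − (a+3)·x − 1 and K = ℚ(α). Then the ring of integers of K equals ℤ[α], the discriminant of K equals m², and moreover {1, α, α′} with α′ = −(α+1)/α is an integral basis of the ring of integers of K. -/

import Mathlib

open Polynomial in
/-- The cubic satisfied by `3 r - a` for a root `r` of `f_a`. -/
noncomputable def auxPoly (a : ℕ) : ℤ[X] :=
  X ^ 3 - C (3 * ((a : ℤ) ^ 2 + 3 * a + 9)) * X - C ((2 * (a : ℤ) + 3) * ((a : ℤ) ^ 2 + 3 * a + 9))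

open Polynomial in
lemma auxPoly_natDegree (a : ℕ) : (auxPoly a).natDegree = 3 := by
  unfold auxPoly; compute_degree!

open Polynomial in
lemma auxPoly_monic (a : ℕ) : (auxPoly a).Monic := by
  unfold auxPoly; monicity!

open Polynomial in
lemma auxPoly_coeff_zero (a : ℕ) :
    (auxPoly a).coeff 0 = - ((2 * (a : ℤ) + 3) * ((a : ℤ) ^ 2 + 3 * a + 9)) := by
  unfold auxPoly
  generalize 3 * ((a : ℤ) ^ 2 + 3 * a + 9) = u
  generalize (2 * (a : ℤ) + 3) * ((a : ℤ) ^ 2 + 3 * a + 9) = v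
  simp

open Polynomial in
lemma auxPoly_coeff_one (a : ℕ) :
    (auxPoly a).coeff 1 = - (3 * ((a : ℤ) ^ 2 + 3 * a + 9)) := by
  unfold auxPoly
  generalize 3 * ((a : ℤ) ^ 2 + 3 * a + 9) = u
  generalize (2 * (a : ℤ) + 3) * ((a : ℤ) ^ 2 + 3 * a + 9) = v
  simp only [coeff_sub, coeff_C_mul, coeff_C, coeff_X_pow, coeff_X]
  norm_num

open Polynomial in
lemma auxPoly_coeff_two (a : ℕ) : (auxPoly a).coeff 2 = 0 := by
  unfold auxPoly
  generalize 3 * ((a : ℤ) ^ 2 + 3 * a + 9) = u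
  generalize (2 * (a : ℤ) + 3) * ((a : ℤ) ^ 2 + 3 * a + 9) = v
  simp only [coeff_sub, coeff_C_mul, coeff_C, coeff_X_pow, coeff_X]
  norm_num

lemma three_not_dvd (a : ℕ) (hsq : Squarefree ((a : ℤ) ^ 2 + 3 * a + 9)) :
    ¬ (3 : ℤ) ∣ (a : ℤ) ^ 2 + 3 * a + 9 := by
  intro h
  have h1 : (3 : ℤ) ∣ (a : ℤ) ^ 2 := by
    have := dvd_sub h (Dvd.intro ((a : ℤ) + 3) rfl)
    ring_nf at this
    simpa using this
  have h2 : (3 : ℤ) ∣ a := Int.prime_three.dvd_of_dvd_pow h1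
  obtain ⟨k, hk⟩ := h2
  have h3 : (3 : ℤ) * 3 ∣ (a : ℤ) ^ 2 + 3 * a + 9 := ⟨k ^ 2 + k + 1, by rw [hk]; ring⟩
  exact Int.prime_three.not_isUnit (hsq 3 h3)

lemma prime_not_dvd_nine (a : ℕ) (hsq : Squarefree ((a : ℤ) ^ 2 + 3 * a + 9)) (p : ℤ)
    (hp : Prime p) (hpm : p ∣ (a : ℤ) ^ 2 + 3 * a + 9) : ¬ p ∣ 3 := by
  intro h
  have := (hp.associated_of_dvd Int.prime_three h).symm.dvd
  exact three_not_dvd a hsq (this.trans hpm)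

open Polynomial in
lemma auxPoly_eis (a : ℕ) (hsq : Squarefree ((a : ℤ) ^ 2 + 3 * a + 9)) (p : ℤ)
    (hp : Prime p) (hpm : p ∣ (a : ℤ) ^ 2 + 3 * a + 9) :
    (auxPoly a).IsEisensteinAt (Submodule.span ℤ {p}) := by
  have h3 := prime_not_dvd_nine a hsq p hp hpm
  refine ⟨?_, ?_, ?_⟩
  · rw [(auxPoly_monic a).leadingCoeff]
    intro h
    exact hp.not_isUnit (isUnit_of_dvd_one (Ideal.mem_span_singleton.1 h))
  · intro n hn
    rw [auxPoly_natDegree] at hn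
    refine Ideal.mem_span_singleton.2 ?_
    interval_cases n
    · rw [auxPoly_coeff_zero]
      exact (dvd_neg.2 (hpm.mul_left _))
    · rw [auxPoly_coeff_one]
      exact (dvd_neg.2 (hpm.mul_left _))
    · rw [auxPoly_coeff_two]
      exact dvd_zero _
  · intro h
    have h' := (Ideal.span_singleton_pow p 2) ▸ h
    have h2 : p ^ 2 ∣ (auxPoly a).coeff 0 := Ideal.mem_span_singleton.1 h'
    have h4 : p ^ 2 ∣ (2 * (a : ℤ) + 3) * ((a : ℤ) ^ 2 + 3 * a + 9) := by
      have : (auxPoly a).coeff 0 = - ((2 * (a : ℤ) + 3) * ((a : ℤ) ^ 2 + 3 * a + 9)) := by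
        exact auxPoly_coeff_zero a
      rw [this] at h2
      exact (dvd_neg.1 h2)
    obtain ⟨k, hk⟩ := hpm
    have h5 : p * p ∣ p * ((2 * (a : ℤ) + 3) * k) := by
      rw [hk] at h4
      convert h4 using 1 <;> ring
    have h6 := (mul_dvd_mul_iff_left hp.ne_zero).1 h5
    rcases hp.dvd_or_dvd h6 with h7 | h7
    · have h8 : p ∣ (3 : ℤ) ^ 3 := by
        have h9 : p ∣ 4 * ((a : ℤ) ^ 2 + 3 * a + 9) - (2 * (a : ℤ) + 3) * (2 * (a : ℤ) + 3) :=
          dvd_sub (Dvd.dvd.mul_left ⟨k, hk⟩ _) (h7.mul_left _)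
        ring_nf at h9 ⊢
        exact h9
      exact h3 (hp.dvd_of_dvd_pow h8)
    · obtain ⟨l, rfl⟩ := h7
      exact hp.not_isUnit (hsq p ⟨l, by rw [hk]; ring⟩)

lemma exists_prime (a : ℕ) : ∃ p : ℤ, Prime p ∧ p ∣ (a : ℤ) ^ 2 + 3 * a + 9 := by
  have h : (a ^ 2 + 3 * a + 9) ≠ 1 := by omega
  obtain ⟨p, hp, hd⟩ := Nat.exists_prime_and_dvd h
  exact ⟨p, Nat.prime_iff_prime_int.1 hp, by exact_mod_cast hd⟩

lemma auxPoly_irred (a : ℕ) (hsq : Squarefree ((a : ℤ) ^ 2 + 3 * a + 9)) :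
    Irreducible (auxPoly a) := by
  obtain ⟨p, hp, hd⟩ := exists_prime a
  exact (auxPoly_eis a hsq p hp hd).irreducible ((Ideal.span_singleton_prime hp.ne_zero).2 hp)
    (auxPoly_monic a).isPrimitive (by rw [auxPoly_natDegree]; norm_num)

section
variable {K : Type*} [Field K] [NumberField K]

open Polynomial in
lemma auxPoly_aeval (a : ℕ) (r : K) (hr : r ^ 3 - (a : K) * r ^ 2 - ((a : K) + 3) * r - 1 = 0) :
    aeval (3 * r - (a : K)) (auxPoly a) = 0 := by
  simp only [auxPoly, map_sub, map_mul, map_pow, aeval_X, aeval_C]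
  simp
  linear_combination 27 * hr

lemma aux_isIntegral (a : ℕ) (r : K)
    (hr : r ^ 3 - (a : K) * r ^ 2 - ((a : K) + 3) * r - 1 = 0) :
    IsIntegral ℤ (3 * r - (a : K)) :=
  ⟨auxPoly a, auxPoly_monic a, auxPoly_aeval a r hr⟩

open Polynomial in
lemma root_isIntegral (a : ℕ) (r : K)
    (hr : r ^ 3 - (a : K) * r ^ 2 - ((a : K) + 3) * r - 1 = 0) :
    IsIntegral ℤ r := by
  refine ⟨X ^ 3 - C (a : ℤ) * X ^ 2 - C ((a : ℤ) + 3) * X - C 1, by monicity!, ?_⟩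
  simpa using hr

open Polynomial in
lemma aux_minpoly_rat (a : ℕ) (hsq : Squarefree ((a : ℤ) ^ 2 + 3 * a + 9)) (r : K)
    (hr : r ^ 3 - (a : K) * r ^ 2 - ((a : K) + 3) * r - 1 = 0) :
    minpoly ℚ (3 * r - (a : K)) = (auxPoly a).map (algebraMap ℤ ℚ) := by
  symm
  apply minpoly.eq_of_irreducible_of_monic
  · exact ((auxPoly_monic a).irreducible_iff_irreducible_map_fraction_map).1 (auxPoly_irred a hsq)
  · rw [aeval_map_algebraMap]
    exact auxPoly_aeval a r hr
  · exact (auxPoly_monic a).map _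

open Polynomial in
lemma aux_minpoly (a : ℕ) (hsq : Squarefree ((a : ℤ) ^ 2 + 3 * a + 9)) (r : K)
    (hr : r ^ 3 - (a : K) * r ^ 2 - ((a : K) + 3) * r - 1 = 0) :
    minpoly ℤ (3 * r - (a : K)) = auxPoly a := by
  have h1 := aux_minpoly_rat a hsq r hr
  rw [minpoly.isIntegrallyClosed_eq_field_fractions' ℚ (aux_isIntegral a r hr)] at h1
  exact map_injective _ (algebraMap ℤ ℚ).injective_int h1

lemma aux_trace_zero (a : ℕ) (hsq : Squarefree ((a : ℤ) ^ 2 + 3 * a + 9)) (r : K)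
    (hr : r ^ 3 - (a : K) * r ^ 2 - ((a : K) + 3) * r - 1 = 0) :
    Algebra.trace ℚ K (3 * r - (a : K)) = 0 := by
  rw [trace_eq_finrank_mul_minpoly_nextCoeff, aux_minpoly_rat a hsq r hr,
    Polynomial.nextCoeff_of_natDegree_pos
      (by rw [(auxPoly_monic a).natDegree_map, auxPoly_natDegree]; norm_num),
    (auxPoly_monic a).natDegree_map, auxPoly_natDegree, Polynomial.coeff_map, auxPoly_coeff_two]
  simp

lemma adjoin_beta (a : ℕ) (r : K) (hgen : IntermediateField.adjoin ℚ {r} = ⊤) :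
    IntermediateField.adjoin ℚ {3 * r - (a : K)} = ⊤ := by
  rw [eq_top_iff, ← hgen, IntermediateField.adjoin_simple_le_iff]
  have h : 3 * r - (a : K) ∈ IntermediateField.adjoin ℚ {3 * r - (a : K)} :=
    IntermediateField.mem_adjoin_simple_self ℚ _
  have h2 : r = (3 * r - (a : K) + (a : K)) / ((3 : ℕ) : K) := by push_cast; field_simp; ring
  have h3 : (3 * r - (a : K) + (a : K)) / ((3 : ℕ) : K) ∈
      IntermediateField.adjoin ℚ {3 * r - (a : K)} :=
    div_mem (add_mem h (natCast_mem _ _)) (natCast_mem _ _)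
  rwa [← h2] at h3

lemma aux_finrank (a : ℕ) (hsq : Squarefree ((a : ℤ) ^ 2 + 3 * a + 9)) (r : K)
    (hr : r ^ 3 - (a : K) * r ^ 2 - ((a : K) + 3) * r - 1 = 0)
    (hgen : IntermediateField.adjoin ℚ {r} = ⊤) : Module.finrank ℚ K = 3 := by
  have h := IntermediateField.adjoin.finrank (K := ℚ) (x := 3 * r - (a : K))
    (Algebra.IsIntegral.isIntegral _)
  rw [adjoin_beta a r hgen, aux_minpoly_rat a hsq r hr, (auxPoly_monic a).natDegree_map,
    auxPoly_natDegree, IntermediateField.finrank_top'] at h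
  exact h

lemma trace_rat (h3 : Module.finrank ℚ K = 3) (q : ℚ) : Algebra.trace ℚ K (q : K) = 3 * q := by
  have := Algebra.trace_algebraMap (S := K) q
  rw [h3] at this
  simpa using this

lemma trace_root (a : ℕ) (hsq : Squarefree ((a : ℤ) ^ 2 + 3 * a + 9))
    (h3 : Module.finrank ℚ K = 3) (r : K)
    (hr : r ^ 3 - (a : K) * r ^ 2 - ((a : K) + 3) * r - 1 = 0) :
    Algebra.trace ℚ K r = a := by
  have h := aux_trace_zero a hsq r hr
  have h1 : 3 * r - (a : K) = (3 : ℚ) • r - (((a : ℚ)) : K) := by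
    rw [Algebra.smul_def]; simp
  rw [h1, map_sub, map_smul, trace_rat h3] at h
  simp at h
  linarith

lemma root_ne_zero (a : ℕ) (r : K)
    (hr : r ^ 3 - (a : K) * r ^ 2 - ((a : K) + 3) * r - 1 = 0) : r ≠ 0 := by
  rintro rfl; simp at hr

lemma conj_eq (a : ℕ) (r : K)
    (hr : r ^ 3 - (a : K) * r ^ 2 - ((a : K) + 3) * r - 1 = 0) :
    -(r + 1) / r = - r ^ 2 + a * r + a + 2 := by
  rw [div_eq_iff (root_ne_zero a r hr)]
  linear_combination hr

lemma conj_root (a : ℕ) (r : K)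
    (hr : r ^ 3 - (a : K) * r ^ 2 - ((a : K) + 3) * r - 1 = 0) :
    (-(r + 1) / r) ^ 3 - (a : K) * (-(r + 1) / r) ^ 2 - ((a : K) + 3) * (-(r + 1) / r) - 1 = 0 := by
  have h0 := root_ne_zero a r hr
  field_simp
  linear_combination hr

lemma trace_root_sq (a : ℕ) (hsq : Squarefree ((a : ℤ) ^ 2 + 3 * a + 9))
    (h3 : Module.finrank ℚ K = 3) (r : K)
    (hr : r ^ 3 - (a : K) * r ^ 2 - ((a : K) + 3) * r - 1 = 0) :
    Algebra.trace ℚ K (r ^ 2) = a ^ 2 + 2 * a + 6 := by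
  have h1 := trace_root a hsq h3 r hr
  have h2 := trace_root a hsq h3 _ (conj_root a r hr)
  have h4 : r ^ 2 = (a : ℚ) • r + (((a : ℚ) + 2 : ℚ) : K) - (-(r + 1) / r) := by
    rw [conj_eq a r hr, Algebra.smul_def]; simp; ring
  rw [h4, map_sub, map_add, map_smul, trace_rat h3, h1, h2]
  simp; ring

lemma trace_mul_conj (a : ℕ) (hsq : Squarefree ((a : ℤ) ^ 2 + 3 * a + 9))
    (h3 : Module.finrank ℚ K = 3) (r : K)
    (hr : r ^ 3 - (a : K) * r ^ 2 - ((a : K) + 3) * r - 1 = 0) :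
    Algebra.trace ℚ K (r * (-(r + 1) / r)) = - a - 3 := by
  have h1 := trace_root a hsq h3 r hr
  have h4 : r * (-(r + 1) / r) = - r - ((1 : ℚ) : K) := by
    have h0 := root_ne_zero a r hr
    field_simp; simp; ring
  rw [h4, map_sub, map_neg, trace_rat h3, h1]; ring


lemma adjoin_form {R : Type*} [CommRing R] [Algebra R K] (r : K) (u v w : R)
    (hr : r ^ 3 = algebraMap R K u * r ^ 2 + algebraMap R K v * r + algebraMap R K w) (z : K)
    (hz : z ∈ Algebra.adjoin R {r}) :
    ∃ c₀ c₁ c₂ : R, z = algebraMap R K c₀ + algebraMap R K c₁ * r + algebraMap R K c₂ * r ^ 2 := by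
  induction hz using Algebra.adjoin_induction with
  | mem x hx =>
    obtain rfl := hx
    exact ⟨0, 1, 0, by simp⟩
  | algebraMap x => exact ⟨x, 0, 0, by simp⟩
  | add x y hx hy h1 h2 =>
    obtain ⟨c₀, c₁, c₂, rfl⟩ := h1
    obtain ⟨d₀, d₁, d₂, rfl⟩ := h2
    exact ⟨c₀ + d₀, c₁ + d₁, c₂ + d₂, by simp only [map_add]; ring⟩
  | mul x y hx hy h1 h2 =>
    obtain ⟨c₀, c₁, c₂, rfl⟩ := h1
    obtain ⟨d₀, d₁, d₂, rfl⟩ := h2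
    refine ⟨c₀ * d₀ + (c₁ * d₂ + c₂ * d₁) * w + c₂ * d₂ * (u * w),
      c₀ * d₁ + c₁ * d₀ + (c₁ * d₂ + c₂ * d₁) * v + c₂ * d₂ * (u * v + w),
      c₀ * d₂ + c₁ * d₁ + c₂ * d₀ + (c₁ * d₂ + c₂ * d₁) * u + c₂ * d₂ * (u ^ 2 + v), ?_⟩
    simp only [map_add, map_mul, map_pow]
    generalize algebraMap R K c₀ = c₀
    generalize algebraMap R K c₁ = c₁
    generalize algebraMap R K c₂ = c₂
    generalize algebraMap R K d₀ = d₀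
    generalize algebraMap R K d₁ = d₁
    generalize algebraMap R K d₂ = d₂
    linear_combination (c₁ * d₂ + c₂ * d₁ + c₂ * d₂ * (r + algebraMap R K u)) * hr

/-- Coordinates with respect to 1, r and the conjugate recovered from traces. -/
lemma coords (a : ℕ) (hsq : Squarefree ((a : ℤ) ^ 2 + 3 * a + 9))
    (h3 : Module.finrank ℚ K = 3) (r : K)
    (hr : r ^ 3 - (a : K) * r ^ 2 - ((a : K) + 3) * r - 1 = 0) (z : K) (c₀ c₁ c₂ : ℚ)
    (hz : z = c₀ + c₁ * r + c₂ * (-(r + 1) / r)) (t₀ t₁ t₂ : ℚ)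
    (h0 : Algebra.trace ℚ K z = t₀) (h1 : Algebra.trace ℚ K (z * r) = t₁)
    (h2 : Algebra.trace ℚ K (z * (-(r + 1) / r)) = t₂) :
    ((a : ℚ) ^ 2 + 3 * a + 9) ^ 2 * c₀ =
      ((a : ℚ) ^ 2 + 3 * a + 9) * ((a ^ 2 + a + 3) * t₀ - a * t₁ - a * t₂) ∧
    ((a : ℚ) ^ 2 + 3 * a + 9) ^ 2 * c₁ =
      ((a : ℚ) ^ 2 + 3 * a + 9) * (- a * t₀) + (2 * a ^ 2 + 6 * a + 18) * t₁
        + ((a : ℚ) ^ 2 + 3 * a + 9) * t₂ ∧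
    ((a : ℚ) ^ 2 + 3 * a + 9) ^ 2 * c₂ =
      ((a : ℚ) ^ 2 + 3 * a + 9) * (- a * t₀) + ((a : ℚ) ^ 2 + 3 * a + 9) * t₁
        + (2 * a ^ 2 + 6 * a + 18) * t₂ := by
  have hr' := conj_root a r hr
  have e1 := trace_root a hsq h3 r hr
  have e2 := trace_root a hsq h3 _ hr'
  have e3 := trace_root_sq a hsq h3 r hr
  have e4 := trace_root_sq a hsq h3 _ hr'
  have e5 := trace_mul_conj a hsq h3 r hr
  generalize (-(r + 1) / r) = s at *
  have k0 : z = (c₀ : K) + c₁ • r + c₂ • s := by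
    simp only [Algebra.smul_def]; simpa using hz
  have k1 : z * r = c₀ • r + c₁ • (r ^ 2) + c₂ • (r * s) := by
    rw [hz]; simp only [Algebra.smul_def, eq_ratCast]; ring
  have k2 : z * s = c₀ • s + c₁ • (r * s) + c₂ • (s ^ 2) := by
    rw [hz]; simp only [Algebra.smul_def, eq_ratCast]; ring
  rw [k0] at h0
  rw [k1] at h1
  rw [k2] at h2
  simp only [map_add, map_smul, trace_rat h3, e1, e2, e3, e4, e5, smul_eq_mul] at h0 h1 h2
  subst h0 h1 h2
  refine ⟨?_, ?_, ?_⟩ <;> ring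

lemma adjoin_rat_top (r : K) (hgen : IntermediateField.adjoin ℚ {r} = ⊤) :
    Algebra.adjoin ℚ {r} = ⊤ := by
  rw [← IntermediateField.adjoin_simple_toSubalgebra_of_isAlgebraic
    (Algebra.IsAlgebraic.isAlgebraic r), hgen]
  rfl

lemma prime_step (a : ℕ) (hsq : Squarefree ((a : ℤ) ^ 2 + 3 * a + 9)) (r : K)
    (hr : r ^ 3 - (a : K) * r ^ 2 - ((a : K) + 3) * r - 1 = 0)
    (hgen : IntermediateField.adjoin ℚ {r} = ⊤) (p : ℤ) (hp : Prime p)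
    (hpm : p ∣ (a : ℤ) ^ 2 + 3 * a + 9) (z : K) (hz : IsIntegral ℤ z)
    (h : (p : K) * z ∈ Algebra.adjoin ℤ {r}) : z ∈ Algebra.adjoin ℤ {r} := by
  obtain ⟨c₀, c₁, c₂, hc⟩ := adjoin_form r (a : ℤ) ((a : ℤ) + 3) 1
    (by simp; linear_combination hr) _ h
  simp only [eq_intCast] at hc
  have hb : (3 * r - (a : K)) ∈ Algebra.adjoin ℤ {3 * r - (a : K)} :=
    Algebra.self_mem_adjoin_singleton _ _
  let B := PowerBasis.ofAdjoinEqTop (K := ℚ) (x := 3 * r - (a : K))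
    (Algebra.IsIntegral.isIntegral _) (adjoin_rat_top _ (adjoin_beta a r hgen))
  have hB : B.gen = 3 * r - (a : K) := PowerBasis.ofAdjoinEqTop_gen _ _
  have h9 : p • (9 * z) ∈ Algebra.adjoin ℤ {B.gen} := by
    rw [hB]
    have : p • (9 * z) = ((9 * c₀ : ℤ) : K) + ((3 * c₁ : ℤ) : K) * (3 * r - (a : K) + ((a : ℤ) : K))
        + (c₂ : K) * (3 * r - (a : K) + ((a : ℤ) : K)) ^ 2 := by
      rw [zsmul_eq_mul]; push_cast
      linear_combination 9 * hc
    rw [this]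
    have hi : ∀ n : ℤ, (n : K) ∈ Algebra.adjoin ℤ {3 * r - (a : K)} := fun n => intCast_mem _ n
    exact add_mem (add_mem (hi _) (mul_mem (hi _) (add_mem hb (hi _))))
      (mul_mem (hi _) (pow_mem (add_mem hb (hi _)) 2))
  have hz9 : IsIntegral ℤ (9 * z) := by
    have : IsIntegral ℤ ((9 : ℤ) • z) := hz.smul 9
    simpa [zsmul_eq_mul] using this
  have key := mem_adjoin_of_smul_prime_smul_of_minpoly_isEisensteinAt (B := B) hp
    (by rw [hB]; exact aux_isIntegral a r hr) hz9 h9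
    (by rw [hB, aux_minpoly a hsq r hr]; exact auxPoly_eis a hsq p hp hpm)
  rw [hB] at key
  have hr0 : r ∈ Algebra.adjoin ℤ {r} := Algebra.self_mem_adjoin_singleton _ _
  have hi : ∀ n : ℤ, (n : K) ∈ Algebra.adjoin ℤ {r} := fun n => intCast_mem _ n
  have hle : Algebra.adjoin ℤ {3 * r - (a : K)} ≤ Algebra.adjoin ℤ {r} := by
    rw [Algebra.adjoin_le_iff, Set.singleton_subset_iff]
    have := sub_mem (mul_mem (hi 3) hr0) (hi a)
    simpa using this
  have key2 := hle key
  have hcop : IsCoprime p 9 := by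
    have : IsCoprime p (3 ^ 2) := IsCoprime.pow_right
      ((hp.irreducible.coprime_iff_not_dvd).2 (prime_not_dvd_nine a hsq p hp hpm))
    simpa using this
  obtain ⟨x, y, hxy⟩ := hcop
  have hxy' : (x : K) * p + y * 9 = 1 := by exact_mod_cast congrArg (Int.cast : ℤ → K) hxy
  have : z = x * (p * z) + y * (9 * z) := by linear_combination -z * hxy'
  rw [this]
  exact add_mem (mul_mem (hi _) h) (mul_mem (hi _) key2)

lemma clear_denominator (a : ℕ) (hsq : Squarefree ((a : ℤ) ^ 2 + 3 * a + 9)) (r : K)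
    (hr : r ^ 3 - (a : K) * r ^ 2 - ((a : K) + 3) * r - 1 = 0)
    (hgen : IntermediateField.adjoin ℚ {r} = ⊤) (n : ℤ) :
    n ∣ ((a : ℤ) ^ 2 + 3 * a + 9) ^ 2 → ∀ z : K, IsIntegral ℤ z →
    (n : K) * z ∈ Algebra.adjoin ℤ {r} → z ∈ Algebra.adjoin ℤ {r} := by
  have hi : ∀ n : ℤ, (n : K) ∈ Algebra.adjoin ℤ {r} := fun n => intCast_mem _ n
  induction n using UniqueFactorizationMonoid.induction_on_prime with
  | h₁ =>
    intro h
    have : (0 : ℤ) < ((a : ℤ) ^ 2 + 3 * a + 9) ^ 2 := by positivity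
    exact absurd (zero_dvd_iff.1 h) this.ne'
  | h₂ x hx =>
    intro _ z _ hz
    obtain ⟨y, hy⟩ := isUnit_iff_exists_inv.1 hx
    have hy' : (x : K) * y = 1 := by exact_mod_cast congrArg (Int.cast : ℤ → K) hy
    have : z = y * (x * z) := by linear_combination -z * hy'
    rw [this]
    exact mul_mem (hi _) hz
  | h₃ b p hb hp ih =>
    intro h z hz hm
    have hpm : p ∣ (a : ℤ) ^ 2 + 3 * a + 9 := hp.dvd_of_dvd_pow ((Dvd.intro b rfl).trans h)
    refine ih ((Dvd.intro_left p rfl).trans h) z hz ?_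
    refine prime_step a hsq r hr hgen p hp hpm _ ?_ ?_
    · have : IsIntegral ℤ (b • z) := hz.smul b
      simpa [zsmul_eq_mul] using this
    · push_cast at hm
      rwa [mul_assoc] at hm

lemma trace_int (z : K) (hz : IsIntegral ℤ z) : ∃ t : ℤ, Algebra.trace ℚ K z = (t : ℚ) := by
  obtain ⟨t, ht⟩ := IsIntegrallyClosed.isIntegral_iff.1 (Algebra.isIntegral_trace (L := ℚ) hz)
  exact ⟨t, by rw [← ht]; simp⟩

lemma integral_mem (a : ℕ) (hsq : Squarefree ((a : ℤ) ^ 2 + 3 * a + 9)) (r : K)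
    (hr : r ^ 3 - (a : K) * r ^ 2 - ((a : K) + 3) * r - 1 = 0)
    (hgen : IntermediateField.adjoin ℚ {r} = ⊤) (z : K) (hz : IsIntegral ℤ z) :
    z ∈ Algebra.adjoin ℤ {r} := by
  have h3 := aux_finrank a hsq r hr hgen
  refine clear_denominator a hsq r hr hgen _ dvd_rfl z hz ?_
  have hi : ∀ n : ℤ, (n : K) ∈ Algebra.adjoin ℤ {r} := fun n => intCast_mem _ n
  have hr0 : r ∈ Algebra.adjoin ℤ {r} := Algebra.self_mem_adjoin_singleton _ _
  have hr1 : -(r + 1) / r ∈ Algebra.adjoin ℤ {r} := by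
    rw [conj_eq a r hr]
    have := add_mem (add_mem (add_mem (neg_mem (pow_mem hr0 2)) (mul_mem (hi a) hr0)) (hi a)) (hi 2)
    simpa using this
  obtain ⟨c₀, c₁, c₂, hc⟩ := adjoin_form (R := ℚ) r (a : ℚ) ((a : ℚ) + 3) 1
    (by simp; linear_combination hr) z (by rw [adjoin_rat_top r hgen]; trivial)
  simp only [eq_ratCast] at hc
  have hc' : z = ((c₀ + c₂ * (a + 2) : ℚ) : K) + ((c₁ + c₂ * a : ℚ) : K) * r +
      ((-c₂ : ℚ) : K) * (-(r + 1) / r) := by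
    rw [conj_eq a r hr, hc]; push_cast; ring
  have hri := root_isIntegral a r hr
  have hri' := root_isIntegral a _ (conj_root a r hr)
  obtain ⟨t₀, h0⟩ := trace_int z hz
  obtain ⟨t₁, h1⟩ := trace_int (z * r) (hz.mul hri)
  obtain ⟨t₂, h2⟩ := trace_int (z * (-(r + 1) / r)) (hz.mul hri')
  obtain ⟨k0, k1, k2⟩ := coords a hsq h3 r hr z _ _ _ hc' _ _ _ h0 h1 h2
  generalize c₀ + c₂ * (a + 2) = d₀ at *
  generalize c₁ + c₂ * a = d₁ at *
  generalize -c₂ = d₂ at *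
  have k0' := congrArg (Rat.cast : ℚ → K) k0
  have k1' := congrArg (Rat.cast : ℚ → K) k1
  have k2' := congrArg (Rat.cast : ℚ → K) k2
  push_cast at k0' k1' k2'
  have : ((((a : ℤ) ^ 2 + 3 * a + 9) ^ 2 : ℤ) : K) * z =
      ((((a : ℤ) ^ 2 + 3 * a + 9) * ((a ^ 2 + a + 3) * t₀ - a * t₁ - a * t₂) : ℤ) : K) +
      ((((a : ℤ) ^ 2 + 3 * a + 9) * (- a * t₀) + (2 * a ^ 2 + 6 * a + 18) * t₁
        + ((a : ℤ) ^ 2 + 3 * a + 9) * t₂ : ℤ) : K) * r +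
      ((((a : ℤ) ^ 2 + 3 * a + 9) * (- a * t₀) + ((a : ℤ) ^ 2 + 3 * a + 9) * t₁
        + (2 * a ^ 2 + 6 * a + 18) * t₂ : ℤ) : K) * (-(r + 1) / r) := by
    rw [hc']
    push_cast
    generalize (-(r + 1) / r) = s at *
    linear_combination k0' + r * k1' + s * k2'
  rw [this]
  exact add_mem (add_mem (hi _) (mul_mem (hi _) hr0)) (mul_mem (hi _) hr1)

end


/-- Let `a ≥ 1` with `m = a² + 3a + 9` squarefree, let `α` be a root of
`f_a = x³ − a·x² − (a+3)·x − 1` and `K = ℚ(α)`. Then the ring of integers of `K`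
equals `ℤ[α]`, the discriminant of `K` equals `m²`, and `{1, α, α′}` with
`α′ = −(α+1)/α` is an integral basis of the ring of integers of `K`. -/
theorem stmt_3 (a : ℕ) (ha : 1 ≤ a) (hsq : Squarefree ((a : ℤ) ^ 2 + 3 * a + 9))
    (K : Type*) [Field K] [NumberField K]
    (α : K) (hα : α ^ 3 - (a : K) * α ^ 2 - ((a : K) + 3) * α - 1 = 0)
    (hgen : IntermediateField.adjoin ℚ {α} = ⊤) :
    (integralClosure ℤ K = Algebra.adjoin ℤ {α}) ∧
    (NumberField.discr K = ((a : ℤ) ^ 2 + 3 * a + 9) ^ 2) ∧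
    (∃ b : Module.Basis (Fin 3) ℤ (NumberField.RingOfIntegers K),
      algebraMap (NumberField.RingOfIntegers K) K (b 0) = 1 ∧
      algebraMap (NumberField.RingOfIntegers K) K (b 1) = α ∧
      algebraMap (NumberField.RingOfIntegers K) K (b 2) = -(α + 1) / α) := by
  
  have h3 := aux_finrank a hsq α hα hgen
  have hαi := root_isIntegral a α hα
  have hr' := conj_root a α hα
  have hαi' := root_isIntegral a _ hr'
  have hR : integralClosure ℤ K = Algebra.adjoin ℤ {α} := by
    apply le_antisymm
    · intro z hz
      exact integral_mem a hsq α hα hgen z hz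
    · rw [Algebra.adjoin_le_iff, Set.singleton_subset_iff]
      exact hαi
  let x : NumberField.RingOfIntegers K := ⟨α, hαi⟩
  let y : NumberField.RingOfIntegers K := ⟨-(α + 1) / α, hαi'⟩
  have hx : algebraMap (NumberField.RingOfIntegers K) K x = α := rfl
  have hy : algebraMap (NumberField.RingOfIntegers K) K y = -(α + 1) / α := rfl
  have hli : LinearIndependent ℤ ![(1 : NumberField.RingOfIntegers K), x, y] := by
    rw [Fintype.linearIndependent_iff]
    intro g hg
    have hg' := congrArg (algebraMap (NumberField.RingOfIntegers K) K) hg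
    simp [Fin.sum_univ_three, hx, hy] at hg'
    have hz : (0 : K) = ((g 0 : ℚ) : K) + ((g 1 : ℚ) : K) * α
        + ((g 2 : ℚ) : K) * (-(α + 1) / α) := by
      push_cast; simpa using hg'.symm
    obtain ⟨k0, k1, k2⟩ := coords a hsq h3 α hα 0 _ _ _ hz 0 0 0 (by simp) (by simp) (by simp)
    have hm : ((a : ℚ) ^ 2 + 3 * a + 9) ^ 2 ≠ 0 := by positivity
    simp [hm] at k0 k1 k2
    intro i
    fin_cases i
    · exact k0
    · exact k1
    · exact k2
  have hsp : ⊤ ≤ Submodule.span ℤ (Set.range ![(1 : NumberField.RingOfIntegers K), x, y]) := by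
    intro z _
    obtain ⟨c₀, c₁, c₂, hc⟩ := adjoin_form (R := ℤ) α (a : ℤ) ((a : ℤ) + 3) 1
      (by simp; linear_combination hα) _ (integral_mem a hsq α hα hgen _ z.2)
    rw [Submodule.mem_span_range_iff_exists_fun]
    refine ⟨![c₀ + c₂ * (a + 2), c₁ + c₂ * a, - c₂], ?_⟩
    apply NumberField.RingOfIntegers.coe_injective
    simp only [eq_intCast] at hc
    have hz : algebraMap (NumberField.RingOfIntegers K) K z = z.1 := rfl
    rw [hz, hc]
    rw [conj_eq a α hα] at hy
    have h2 : algebraMap (NumberField.RingOfIntegers K) K 2 = 2 := map_ofNat _ 2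
    simp [Fin.sum_univ_three, hx, hy, h2]
    ring
  let b := Module.Basis.mk hli hsp
  have hb0 : b 0 = 1 := by simp [b]
  have hb1 : b 1 = x := by simp [b]
  have hb2 : b 2 = y := by simp [b]
  refine ⟨hR, ?_, b, ?_, ?_, ?_⟩
  · rw [← NumberField.discr_eq_discr K b, Algebra.discr_def, Matrix.det_fin_three]
    simp only [Algebra.traceMatrix_apply, Algebra.traceForm_apply, hb0, hb1, hb2]
    have e1 := trace_root a hsq h3 α hα
    have e2 := trace_root a hsq h3 _ hr'
    have e3 := trace_root_sq a hsq h3 α hα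
    have e4 := trace_root_sq a hsq h3 _ hr'
    have e5 := trace_mul_conj a hsq h3 α hα
    have e0 := trace_rat h3 1
    have hq : ∀ u v : ℤ, (u : ℚ) = v → u = v := fun u v h => by exact_mod_cast h
    apply hq
    have e5' := e5
    rw [mul_comm] at e5'
    rw [pow_two] at e3 e4
    push_cast [Algebra.coe_trace_int]
    simp only [map_mul, map_one, hx, hy, one_mul, mul_one]
    rw [Rat.cast_one] at e0
    rw [e0, e1, e2, e3, e4, e5, e5']
    ring
  · rw [hb0, map_one]
  · rw [hb1, hx]
  · rw [hb2, hy]
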